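/- arXiv:0711.4414 — 8 statements merged into one kernel-verified Lean document; each statement's English description precedes it below -/
import Mathlib

section
/- Let H_k ∈ ℂ^{M×N} be the primary user's channel matrix, S_k ∈ ℂ^{N×N} a Hermitian positive semidefinite primary transmit covariance matrix, G ∈ ℂ^{M×M_t} the channel from the secondary transmitter to the primary receiver, φ > 0 the noise power, and Γ ≥ 0. Suppose S ∈ ℂ^{M_t×M_t} is Hermitian positive semidefinite with Tr(G S G^†) ≤ Γ, and set Q = G S G^†. Define C₁ = log₂ det(I + (φI + Q)^{-1/2} H_k S_k H_k^† (φI + Q)^{-1/2}) and C₂ = log₂ det(I + (1/φ) H_k S_k H_k^†). Then C₂ − C₁ ≤ min(M,N) · log₂(1 + Γ/φ). -/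
open Matrix
open scoped ComplexOrder

namespace Matrix

open scoped MatrixOrder in
/-- A positive semidefinite complex matrix is of the form `Bᴴ * B`. -/
theorem PosSemidef.exists_conjTranspose_mul_self {n : Type*} [Fintype n] [DecidableEq n]
    {A : Matrix n n ℂ} (hA : A.PosSemidef) : ∃ B : Matrix n n ℂ, A = Bᴴ * B := by
  exact CStarAlgebra.nonneg_iff_eq_star_mul_self.mp (nonneg_iff_posSemidef.mpr hA)

/-- The determinant of `1 + E` is at least `1` when `E` is positive semidefinite. -/
theorem PosSemidef.one_le_det_one_add {n : Type*} [Fintype n] [DecidableEq n]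
    {E : Matrix n n ℂ} (hE : E.PosSemidef) : 1 ≤ (1 + E).det := by
  have h : (1 + E).det = ((∏ i, (1 + hE.1.eigenvalues i) : ℝ) : ℂ) := by
    conv_lhs => rw [hE.1.spectral_theorem]
    rw [← map_one (Unitary.conjStarAlgAut ℂ _ hE.1.eigenvectorUnitary), ← map_add,
      Unitary.conjStarAlgAut_apply, det_mul_right_comm, ← diagonal_one, diagonal_add]
    simp
  rw [h]
  have h1 : (1 : ℝ) ≤ ∏ i, (1 + hE.1.eigenvalues i) := by
    simpa using Finset.prod_le_prod (s := Finset.univ) (fun _ _ => zero_le_one)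
      fun i _ => le_add_of_nonneg_right (a := (1 : ℝ)) (hE.eigenvalues_nonneg i)
  exact_mod_cast h1

/-- Adding a positive semidefinite matrix does not decrease the determinant of a positive
definite matrix. -/
theorem PosDef.det_le_det_add {n : Type*} [Fintype n] [DecidableEq n]
    {X D : Matrix n n ℂ} (hX : X.PosDef) (hD : D.PosSemidef) : X.det ≤ (X + D).det := by
  obtain ⟨B, rfl⟩ := hD.exists_conjTranspose_mul_self
  rw [det_add_mul _ _ hX.det_pos.ne'.isUnit]
  exact le_mul_of_one_le_right hX.det_pos.le
    (hX.inv.posSemidef.mul_mul_conjTranspose_same B).one_le_det_one_add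

/-- A positive semidefinite matrix is bounded by its trace in the Loewner order. -/
theorem PosSemidef.smul_one_sub_of_trace_le {n : Type*} [Fintype n] [DecidableEq n]
    {Q : Matrix n n ℂ} (hQ : Q.PosSemidef) {Γ : ℝ} (h : Q.trace.re ≤ Γ) :
    ((Γ : ℂ) • (1 : Matrix n n ℂ) - Q).PosSemidef := by
  have hle (i : n) : hQ.1.eigenvalues i ≤ Γ := by
    refine le_trans ?_ h
    rw [hQ.1.trace_eq_sum_eigenvalues]
    simpa using Finset.single_le_sum (fun j _ => hQ.eigenvalues_nonneg j) (Finset.mem_univ i)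
  rw [hQ.1.spectral_theorem, ← map_one (Unitary.conjStarAlgAut ℂ _ hQ.1.eigenvectorUnitary),
    ← map_smul, ← map_sub, Unitary.conjStarAlgAut_apply]
  refine PosSemidef.mul_mul_conjTranspose_same ?_ _
  rw [smul_one_eq_diagonal, diagonal_sub]
  refine PosSemidef.diagonal fun i => ?_
  simpa using hle i

/-- Scaling a positive semidefinite perturbation of the identity by `c⁻¹ ≤ 1` costs at most a
factor `c ^ n` in the determinant. -/
theorem PosSemidef.det_one_add_le {n : Type*} [Fintype n] [DecidableEq n]
    {K : Matrix n n ℂ} (hK : K.PosSemidef) {c : ℝ} (hc : 1 ≤ c) :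
    (1 + K).det ≤ (c : ℂ) ^ Fintype.card n * (1 + (c : ℂ)⁻¹ • K).det := by
  have hc0 : (c : ℂ) ≠ 0 := by exact_mod_cast (by linarith : c ≠ 0)
  have h : (c : ℂ) • (1 + (c : ℂ)⁻¹ • K) = 1 + K + ((c - 1 : ℝ) : ℂ) • (1 : Matrix n n ℂ) := by
    rw [smul_add, smul_inv_smul₀ hc0]
    push_cast
    module
  rw [← det_smul, h]
  refine (PosDef.one.add_posSemidef hK).det_le_det_add (PosSemidef.one.smul ?_)
  exact_mod_cast sub_nonneg.mpr hc

/-- If `R * R` is bounded above by `t`, then `R⁻¹ * R⁻¹` is bounded below by `t⁻¹`. -/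
theorem PosDef.inv_mul_inv_sub {n : Type*} [Fintype n] [DecidableEq n]
    {R : Matrix n n ℂ} (hR : R.PosDef) {t : ℝ} (ht : 0 < t)
    (h : ((t : ℂ) • (1 : Matrix n n ℂ) - R * R).PosSemidef) :
    (R⁻¹ * R⁻¹ - (t : ℂ)⁻¹ • (1 : Matrix n n ℂ)).PosSemidef := by
  have hu : IsUnit R.det := hR.det_pos.ne'.isUnit
  have ht0 : (t : ℂ) ≠ 0 := by exact_mod_cast ht.ne'
  have hti : (0 : ℂ) ≤ (t : ℂ)⁻¹ := by exact_mod_cast (inv_pos.mpr ht).le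
  have key := (h.conjTranspose_mul_mul_same R⁻¹).smul hti
  rw [hR.inv.1.eq] at key
  convert key using 1
  rw [mul_sub, sub_mul, ← mul_assoc R⁻¹ R R, nonsing_inv_mul _ hu, one_mul,
    mul_nonsing_inv _ hu, mul_smul_comm, mul_one, smul_mul_assoc, smul_sub,
    inv_smul_smul₀ ht0]

end Matrix

/-- Primary-user capacity loss bound: with `R` the positive semidefinite square root of
`φI + Q` (where `Q = G S Gᴴ` is the interference covariance), the capacity loss
`C₂ - C₁` of the primary transmission is at most `min(M,N) · log₂(1 + Γ/φ)`. -/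
theorem stmt_0 (M N Mt : ℕ)
    (Hk : Matrix (Fin M) (Fin N) ℂ)
    (Sk : Matrix (Fin N) (Fin N) ℂ) (hSk : Sk.PosSemidef)
    (G : Matrix (Fin M) (Fin Mt) ℂ)
    (φ Γ : ℝ) (hφ : 0 < φ) (hΓ : 0 ≤ Γ)
    (S : Matrix (Fin Mt) (Fin Mt) ℂ) (hS : S.PosSemidef)
    (hIc : (G * S * Gᴴ).trace.re ≤ Γ)
    (R : Matrix (Fin M) (Fin M) ℂ) (hR : R.PosSemidef)
    (hRsq : R * R = (φ : ℂ) • (1 : Matrix (Fin M) (Fin M) ℂ) + G * S * Gᴴ) :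
    Real.logb 2 ((1 + (φ : ℂ)⁻¹ • (Hk * Sk * Hkᴴ)).det.re)
      - Real.logb 2 ((1 + R⁻¹ * (Hk * Sk * Hkᴴ) * R⁻¹).det.re)
      ≤ ((min M N : ℕ) : ℝ) * Real.logb 2 (1 + Γ / φ) := by
  obtain ⟨C, rfl⟩ := hSk.exists_conjTranspose_mul_self
  set A : Matrix (Fin M) (Fin N) ℂ := Hk * Cᴴ with hA
  have hW : Hk * (Cᴴ * C) * Hkᴴ = A * Aᴴ := by
    simp [hA, Matrix.mul_assoc]
  rw [hW]
  have hφC : (0 : ℂ) < φ := by exact_mod_cast hφ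
  have hφi : (0 : ℂ) ≤ (φ : ℂ)⁻¹ := by exact_mod_cast (inv_pos.mpr hφ).le
  have hQ : (G * S * Gᴴ).PosSemidef := hS.mul_mul_conjTranspose_same G
  set c : ℝ := 1 + Γ / φ with hc
  have hc1 : 1 ≤ c := by
    have := div_nonneg hΓ hφ.le
    linarith
  have hc0 : 0 < c := by linarith
  have hcφ : c * φ = φ + Γ := by
    rw [hc]
    field_simp
  have hRR : (R * R).PosDef := by
    rw [hRsq]
    exact (PosDef.one.smul hφC).add_posSemidef hQ
  have hRpd : R.PosDef := by
    rw [hR.posDef_iff_det_ne_zero]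
    have := hRR.det_pos.ne'
    rw [det_mul] at this
    exact left_ne_zero_of_mul this
  have hbound : (((c * φ : ℝ) : ℂ) • (1 : Matrix (Fin M) (Fin M) ℂ) - R * R).PosSemidef := by
    convert hQ.smul_one_sub_of_trace_le hIc using 1
    rw [hRsq, hcφ]
    push_cast
    module
  have hinv := hRpd.inv_mul_inv_sub (mul_pos hc0 hφ) hbound
  set κ : ℂ := ((c * φ : ℝ) : ℂ)⁻¹ with hκ
  have hκ0 : 0 ≤ κ := by
    rw [hκ]
    exact_mod_cast (inv_pos.mpr (mul_pos hc0 hφ)).le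
  have hκc : κ = (c : ℂ)⁻¹ * (φ : ℂ)⁻¹ := by
    rw [hκ]
    push_cast
    rw [mul_inv]
  have hX : (1 + κ • (Aᴴ * A)).PosDef :=
    PosDef.one.add_posSemidef ((posSemidef_conjTranspose_mul_self A).smul hκ0)
  have hswap (z : ℂ) : (1 + z • (A * Aᴴ)).det = (1 + z • (Aᴴ * A)).det := by
    rw [← Matrix.smul_mul, det_one_add_mul_comm, Matrix.mul_smul]
  have hlow : (1 + κ • (Aᴴ * A)).det ≤ (1 + R⁻¹ * (A * Aᴴ) * R⁻¹).det := by
    have h := hX.det_le_det_add (hinv.conjTranspose_mul_mul_same A)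
    convert h using 1
    rw [show R⁻¹ * (A * Aᴴ) * R⁻¹ = (R⁻¹ * A) * (Aᴴ * R⁻¹) by simp only [Matrix.mul_assoc],
      det_one_add_mul_comm]
    congr 1
    simp only [Matrix.mul_sub, Matrix.sub_mul, Matrix.mul_assoc, Matrix.smul_mul,
      Matrix.mul_smul, Matrix.one_mul]
    abel
  have hup : (1 + (φ : ℂ)⁻¹ • (A * Aᴴ)).det ≤
      (c : ℂ) ^ min M N * (1 + κ • (Aᴴ * A)).det := by
    rcases min_choice M N with h | h <;> rw [h]
    · have := ((posSemidef_self_mul_conjTranspose A).smul hφi).det_one_add_le hc1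
      rwa [smul_smul, ← hκc, hswap κ, Fintype.card_fin] at this
    · have := ((posSemidef_conjTranspose_mul_self A).smul hφi).det_one_add_le hc1
      rwa [smul_smul, ← hκc, ← hswap (φ : ℂ)⁻¹, Fintype.card_fin] at this
  have hcpow : (0 : ℂ) ≤ (c : ℂ) ^ min M N := by exact_mod_cast (pow_pos hc0 _).le
  have hle := Complex.re_le_re (hup.trans (mul_le_mul_of_nonneg_left hlow hcpow))
  rw [← Complex.ofReal_pow, Complex.re_ofReal_mul] at hle
  have hd1 : 0 < (1 + R⁻¹ * (A * Aᴴ) * R⁻¹).det.re :=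
    (Complex.pos_iff.mp (hX.det_pos.trans_le hlow)).1
  have hd2 : 0 < (1 + (φ : ℂ)⁻¹ • (A * Aᴴ)).det.re :=
    (Complex.pos_iff.mp (PosDef.one.add_posSemidef
      ((posSemidef_self_mul_conjTranspose A).smul hφi)).det_pos).1
  have hlog := Real.logb_le_logb_of_le one_lt_two hd2 hle
  rw [Real.logb_mul (pow_pos hc0 _).ne' hd1.ne', Real.logb_pow] at hlog
  linarith
end

section
/- Let h ∈ ℂ^{1×M_t} be a nonzero row vector (the MISO secondary channel), g ∈ ℂ^{1×M_t} a row vector (the channel to a single-antenna primary receiver), P_t > 0, and γ ≥ 0. Consider maximizing log₂(1 + h S h^†) over all Hermitian positive semidefinite S ∈ ℂ^{M_t×M_t} with Tr(S) ≤ P_t and g S g^† ≤ γ. Then there exists an optimal S of rank at most one; that is, there exists a vector v ∈ ℂ^{M_t} with ‖v‖² ≤ P_t and |g v|² ≤ γ such that log₂(1 + |h v|²) equals the supremum of the problem. -/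
open Matrix
open scoped ComplexOrder

open scoped MatrixOrder in
/-- Cauchy–Schwarz for the sesquilinear form of a positive semidefinite matrix. -/
theorem Matrix.PosSemidef.norm_dotProduct_mulVec_sq_le {n : Type*} [Fintype n]
    {S : Matrix n n ℂ} (hS : S.PosSemidef) (x y : n → ℂ) :
    ‖star x ⬝ᵥ S *ᵥ y‖ ^ 2 ≤ (star x ⬝ᵥ S *ᵥ x).re * (star y ⬝ᵥ S *ᵥ y).re := by
  classical
  obtain ⟨B, rfl⟩ := CStarAlgebra.nonneg_iff_eq_star_mul_self.mp hS.nonneg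
  have key (a b : n → ℂ) : star a ⬝ᵥ (star B * B) *ᵥ b =
      inner ℂ (WithLp.toLp 2 (B *ᵥ a)) (WithLp.toLp 2 (B *ᵥ b)) := by
    rw [EuclideanSpace.inner_eq_star_dotProduct, ← Matrix.mulVec_mulVec,
      Matrix.star_eq_conjTranspose, Matrix.dotProduct_mulVec, ← Matrix.star_mulVec, dotProduct_comm]
  rw [key, key, key, ← RCLike.re_eq_complex_re, inner_self_eq_norm_sq, inner_self_eq_norm_sq,
    ← mul_pow]
  gcongr
  exact norm_inner_le_norm _ _

/-- The diagonal quadratic form of a row vector, written with `mulVec`. -/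
theorem rowVector_mul_mul_conjTranspose_apply {n : Type*} [Fintype n]
    (a : Matrix (Fin 1) n ℂ) (S : Matrix n n ℂ) :
    (a * S * aᴴ) 0 0 = star (star (a 0)) ⬝ᵥ S *ᵥ star (a 0) := by
  rw [star_star, Matrix.dotProduct_mulVec]
  rfl

/-- A positive semidefinite `S` dominates a rank-one `v vᴴ` with the same value of the quadratic
form at a prescribed vector `x`. -/
theorem Matrix.PosSemidef.exists_rankOne_le {n : Type*} [Fintype n]
    {S : Matrix n n ℂ} (hS : S.PosSemidef) (x : n → ℂ) :
    ∃ v : n → ℂ, (∀ y, ‖star y ⬝ᵥ v‖ ^ 2 ≤ (star y ⬝ᵥ S *ᵥ y).re) ∧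
      ‖star x ⬝ᵥ v‖ ^ 2 = (star x ⬝ᵥ S *ᵥ x).re := by
  have hnn (y : n → ℂ) : 0 ≤ (star y ⬝ᵥ S *ᵥ y).re := hS.re_dotProduct_nonneg y
  set q := (star x ⬝ᵥ S *ᵥ x).re with hq
  have hqx : star x ⬝ᵥ S *ᵥ x = (q : ℂ) :=
    Complex.ext rfl (by simpa using hS.isHermitian.im_star_dotProduct_mulVec_self x)
  rcases (hnn x).eq_or_lt with h0 | hpos
  · exact ⟨0, fun y => by simpa using hnn y, by simpa using h0⟩
  · have hval (y : n → ℂ) : ‖star y ⬝ᵥ (((√q)⁻¹ : ℝ) : ℂ) • S *ᵥ x‖ ^ 2 =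
        ‖star y ⬝ᵥ S *ᵥ x‖ ^ 2 / q := by
      rw [dotProduct_smul, norm_smul, mul_pow, Complex.norm_real, Real.norm_eq_abs, sq_abs,
        inv_pow, Real.sq_sqrt hpos.le, div_eq_inv_mul]
    refine ⟨(((√q)⁻¹ : ℝ) : ℂ) • S *ᵥ x, fun y => ?_, ?_⟩
    · rw [hval, div_le_iff₀ hpos]
      exact hS.norm_dotProduct_mulVec_sq_le y x
    · rw [hval, hqx, Complex.norm_real, Real.norm_eq_abs, sq_abs, sq, mul_div_assoc,
        div_self hpos.ne', mul_one]

/-- The quadratic form of `v vᴴ` at a row vector. -/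
theorem re_rowVector_mul_vecMulVec_mul_conjTranspose {n : Type*} [Fintype n]
    (a : Matrix (Fin 1) n ℂ) (v : n → ℂ) :
    ((a * vecMulVec v (star v) * aᴴ) 0 0).re = ‖∑ i, a 0 i * v i‖ ^ 2 := by
  rw [rowVector_mul_mul_conjTranspose_apply, Matrix.vecMulVec_mulVec, star_star, dotProduct_smul,
    MulOpposite.smul_eq_mul_unop, MulOpposite.unop_op]
  change (a 0 ⬝ᵥ v * (star v ⬝ᵥ star (a 0))).re = ‖a 0 ⬝ᵥ v‖ ^ 2
  generalize (a 0 : n → ℂ) = b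
  rw [Matrix.star_dotProduct_star, Complex.star_def, Complex.mul_conj, Complex.ofReal_re,
    Complex.normSq_eq_norm_sq]

/-- Some vector of bounded norm and bounded interference maximizes the received amplitude. -/
theorem exists_beamformer_maximizing {n : Type*} [Fintype n] (h g : n → ℂ) {P γ : ℝ}
    (hP : 0 ≤ P) (hγ : 0 ≤ γ) :
    ∃ v : n → ℂ, (∑ i, ‖v i‖ ^ 2 ≤ P ∧ ‖∑ i, g i * v i‖ ^ 2 ≤ γ) ∧
      ∀ w : n → ℂ, ∑ i, ‖w i‖ ^ 2 ≤ P → ‖∑ i, g i * w i‖ ^ 2 ≤ γ →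
        ‖∑ i, h i * w i‖ ≤ ‖∑ i, h i * v i‖ := by
  let K : Set (n → ℂ) := {v | ∑ i, ‖v i‖ ^ 2 ≤ P ∧ ‖∑ i, g i * v i‖ ^ 2 ≤ γ}
  have hclosed : IsClosed K :=
    IsClosed.and (isClosed_le (by fun_prop) continuous_const)
      (isClosed_le (by fun_prop) continuous_const)
  have hsub : K ⊆ Metric.closedBall 0 (√P) := fun v hv => by
    rw [mem_closedBall_zero_iff, pi_norm_le_iff_of_nonneg (Real.sqrt_nonneg P)]
    exact fun i => Real.le_sqrt_of_sq_le <|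
      (Finset.single_le_sum (f := fun i => ‖v i‖ ^ 2) (fun _ _ => sq_nonneg _)
        (Finset.mem_univ i)).trans hv.1
  obtain ⟨v, hv, hmax⟩ := ((isCompact_closedBall _ _).of_isClosed_subset hclosed
    hsub).exists_isMaxOn ⟨0, by simp [hP], by simp [hγ]⟩
    (f := fun v : n → ℂ => ‖∑ i, h i * v i‖) (by fun_prop)
  exact ⟨v, hv, fun w hw₁ hw₂ => hmax ⟨hw₁, hw₂⟩⟩

/-- MISO secondary channel: beamforming (a rank-one transmit covariance `S = v vᴴ`)
achieves the supremum of `log₂(1 + h S hᴴ)` subject to `Tr S ≤ Pt` and `g S gᴴ ≤ γ`. -/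
theorem stmt_1 (Mt : ℕ)
    (h g : Matrix (Fin 1) (Fin Mt) ℂ) (hh : h ≠ 0)
    (Pt γ : ℝ) (hPt : 0 < Pt) (hγ : 0 ≤ γ) :
    ∃ v : Fin Mt → ℂ,
      (∑ i, ‖v i‖ ^ 2) ≤ Pt ∧
      ‖∑ i, g 0 i * v i‖ ^ 2 ≤ γ ∧
      Real.logb 2 (1 + ‖∑ i, h 0 i * v i‖ ^ 2) =
        sSup {r : ℝ | ∃ S : Matrix (Fin Mt) (Fin Mt) ℂ, S.PosSemidef ∧
          S.trace.re ≤ Pt ∧ ((g * S * gᴴ) 0 0).re ≤ γ ∧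
          r = Real.logb 2 (1 + ((h * S * hᴴ) 0 0).re)} := by
  obtain ⟨v, ⟨hvP, hvγ⟩, hmax⟩ := exists_beamformer_maximizing (h 0) (g 0) hPt.le hγ
  refine ⟨v, hvP, hvγ, (IsGreatest.csSup_eq ⟨?_, ?_⟩).symm⟩
  · refine ⟨vecMulVec v (star v), posSemidef_vecMulVec_self_star v, ?_, ?_, ?_⟩
    · rw [trace_vecMulVec]
      simpa [dotProduct, Complex.mul_conj, Complex.normSq_eq_norm_sq, ← Complex.ofReal_pow]
        using hvP
    · rwa [re_rowVector_mul_vecMulVec_mul_conjTranspose]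
    · rw [re_rowVector_mul_vecMulVec_mul_conjTranspose]
  · rintro r ⟨S, hS, hSP, hSγ, rfl⟩
    obtain ⟨w, hw, hwh⟩ := hS.exists_rankOne_le (star (h 0))
    rw [rowVector_mul_mul_conjTranspose_apply] at hSγ ⊢
    have hwP : ∑ i, ‖w i‖ ^ 2 ≤ Pt := by
      refine le_trans ?_ hSP
      rw [trace, Complex.re_sum]
      refine Finset.sum_le_sum fun i _ => ?_
      simpa [← Pi.single_star] using hw (Pi.single i 1)
    have hwγ := (hw (star (g 0))).trans hSγ
    rw [star_star] at hwγ
    rw [← hwh]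
    have hle := hmax w hwP hwγ
    refine Real.logb_le_logb_of_le one_lt_two (by positivity) ?_
    rw [star_star]
    change 1 + ‖∑ i, h 0 i * w i‖ ^ 2 ≤ _
    gcongr
end

section
/- Let h ∈ ℂ^{1×M_t} and g ∈ ℂ^{1×M_t} be row vectors with g ≠ 0, and let ĝ = g^†/‖g‖ and h⊥ = h^† − (ĝ^† h^†) ĝ, with ĥ⊥ = h⊥/‖h⊥‖ when h⊥ ≠ 0. Then for every v ∈ ℂ^{M_t} satisfying ‖v‖² ≤ P_t and |g v|² ≤ γ, there exist complex numbers α_v, β_v such that the vector v' = α_v ĝ + β_v ĥ⊥ also satisfies ‖v'‖² ≤ P_t and |g v'|² ≤ γ, and |h v'| ≥ |h v|. Consequently the maximum of |h v|² over the constraint set is attained by a vector lying in the span of ĝ and ĥ⊥. -/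
/-- Dot product of a row vector `a` with a column vector `b`. -/
noncomputable def rdot {n : ℕ} (a b : Fin n → ℂ) : ℂ := ∑ i, a i * b i

/-- Squared Euclidean norm of a complex vector. -/
noncomputable def enorm2 {n : ℕ} (v : Fin n → ℂ) : ℝ := ∑ i, ‖v i‖ ^ 2

/-- Euclidean norm of a complex vector. -/
noncomputable def enorm {n : ℕ} (v : Fin n → ℂ) : ℝ := Real.sqrt (enorm2 v)

/-- `ĝ = g† / ‖g‖` : the unit column vector in the direction of `g†`. -/
noncomputable def ghat {n : ℕ} (g : Fin n → ℂ) : Fin n → ℂ :=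
  fun i => (starRingEnd ℂ) (g i) / (enorm g : ℂ)

/-- `h⊥ = h† − (ĝ† h†) ĝ` : projection of `h†` onto the orthogonal complement of `ĝ`. -/
noncomputable def hperp {n : ℕ} (g h : Fin n → ℂ) : Fin n → ℂ :=
  fun i => (starRingEnd ℂ) (h i)
    - (∑ j, (starRingEnd ℂ) (ghat g j) * (starRingEnd ℂ) (h j)) * ghat g i

/-- `ĥ⊥ = h⊥ / ‖h⊥‖`. -/
noncomputable def hhatperp {n : ℕ} (g h : Fin n → ℂ) : Fin n → ℂ :=
  fun i => hperp g h i / (enorm (hperp g h) : ℂ)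

open WithLp in
theorem enorm2_eq_norm_sq {n : ℕ} (v : Fin n → ℂ) : enorm2 v = ‖toLp 2 v‖ ^ 2 := by
  simp [enorm2, EuclideanSpace.norm_sq_eq]

open WithLp in
theorem enorm_eq_norm {n : ℕ} (v : Fin n → ℂ) : _root_.enorm v = ‖toLp 2 v‖ := by
  rw [_root_.enorm, enorm2_eq_norm_sq, Real.sqrt_sq (norm_nonneg _)]

open WithLp in
theorem rdot_eq_inner {n : ℕ} (a b : Fin n → ℂ) :
    rdot a b = inner ℂ (toLp 2 (star a)) (toLp 2 b) := by
  simp [rdot, PiLp.inner_apply, mul_comm]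

open WithLp in
theorem toLp_ghat {n : ℕ} (g : Fin n → ℂ) :
    toLp 2 (ghat g) = ((‖toLp 2 (star g)‖ : ℂ)⁻¹) • toLp 2 (star g) := by
  have hn : _root_.enorm g = ‖toLp 2 (star g)‖ := by
    rw [enorm_eq_norm, EuclideanSpace.norm_eq, EuclideanSpace.norm_eq]
    simp
  ext i
  simp [ghat, hn, div_eq_inv_mul]

open WithLp in
theorem toLp_hperp {n : ℕ} (g h : Fin n → ℂ) :
    toLp 2 (hperp g h) = toLp 2 (star h)
      - inner ℂ (toLp 2 (ghat g)) (toLp 2 (star h)) • toLp 2 (ghat g) := by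
  ext i
  simp [hperp, PiLp.inner_apply, mul_comm]

open WithLp in
theorem toLp_hhatperp {n : ℕ} (g h : Fin n → ℂ) :
    toLp 2 (hhatperp g h) = ((‖toLp 2 (hperp g h)‖ : ℂ)⁻¹) • toLp 2 (hperp g h) := by
  ext i
  simp [hhatperp, enorm_eq_norm, div_eq_inv_mul]

section InnerProductSpace

variable {E : Type*} [NormedAddCommGroup E] [InnerProductSpace ℂ E]

theorem norm_inv_smul_smul_self (x : E) : (‖x‖ : ℂ) • ((‖x‖ : ℂ)⁻¹ • x) = x := by
  rcases eq_or_ne x 0 with rfl | hx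
  · simp
  · exact smul_inv_smul₀ (by simpa using hx) x

theorem inner_normalize_smul_normalize (x : E) :
    inner ℂ ((‖x‖ : ℂ)⁻¹ • x) ((‖x‖ : ℂ)⁻¹ • x) • ((‖x‖ : ℂ)⁻¹ • x) = (‖x‖ : ℂ)⁻¹ • x := by
  rcases eq_or_ne x 0 with rfl | hx
  · simp
  · have hx' : (‖x‖ : ℂ) ≠ 0 := by simpa using hx
    have h1 : inner ℂ ((‖x‖ : ℂ)⁻¹ • x) ((‖x‖ : ℂ)⁻¹ • x) = (1 : ℂ) := by
      rw [inner_self_eq_norm_sq_to_K, norm_smul]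
      simp [hx]
    rw [h1, one_smul]

theorem inner_mul_inner_self_of_smul_eq {x : E} (hx : inner ℂ x x • x = x) (v : E) :
    inner ℂ x v * inner ℂ x x = inner ℂ x v := by
  conv_rhs => rw [← hx, inner_smul_left, inner_conj_symm]
  ring

/-- The projection formula onto the span of two orthogonal vectors, each a unit vector or zero,
preserves inner products with both vectors. -/
theorem inner_projection_pair {u w : E} (huw : inner ℂ u w = 0)
    (hu : inner ℂ u u • u = u) (hw : inner ℂ w w • w = w) (v : E) :
    inner ℂ u (inner ℂ u v • u + inner ℂ w v • w) = inner ℂ u v ∧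
      inner ℂ w (inner ℂ u v • u + inner ℂ w v • w) = inner ℂ w v := by
  have hwu : inner ℂ w u = 0 := inner_eq_zero_symm.mp huw
  constructor
  · rw [inner_add_right, inner_smul_right, inner_smul_right, huw, mul_zero, add_zero, inner_mul_inner_self_of_smul_eq hu]
  · rw [inner_add_right, inner_smul_right, inner_smul_right, hwu, mul_zero, zero_add, inner_mul_inner_self_of_smul_eq hw]

theorem norm_projection_pair_le {u w : E} (huw : inner ℂ u w = 0)
    (hu : inner ℂ u u • u = u) (hw : inner ℂ w w • w = w) (v : E) :
    ‖inner ℂ u v • u + inner ℂ w v • w‖ ≤ ‖v‖ := by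
  obtain ⟨h1, h2⟩ := inner_projection_pair huw hu hw v
  set p := inner ℂ u v • u + inner ℂ w v • w with hp
  have horth : inner ℂ p (v - p) = 0 := by
    conv_lhs => rw [hp, inner_add_left, inner_smul_left, inner_smul_left]
    rw [← hp, inner_sub_right, inner_sub_right, h1, h2]
    simp
  have := norm_add_sq_eq_norm_sq_add_norm_sq_of_inner_eq_zero p (v - p) horth
  rw [add_sub_cancel] at this
  nlinarith [norm_nonneg p, norm_nonneg v, mul_self_nonneg ‖v - p‖]

end InnerProductSpace

open WithLp in
theorem inner_ghat_hhatperp {n : ℕ} (g h : Fin n → ℂ) :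
    inner ℂ (toLp 2 (ghat g)) (toLp 2 (hhatperp g h)) = 0 := by
  have hu := inner_normalize_smul_normalize (toLp 2 (star g))
  rw [← toLp_ghat] at hu
  rw [toLp_hhatperp, inner_smul_right, toLp_hperp, inner_sub_right, inner_smul_right,
    inner_mul_inner_self_of_smul_eq hu, sub_self, mul_zero]

open WithLp in
/-- Projecting onto the span of `ghat g` and `hhatperp g h` does not increase the norm and
preserves the products with `g` and `h`. -/
theorem exists_projection {n : ℕ} (h g v : Fin n → ℂ) :
    ∃ α β : ℂ,
      enorm2 (fun i => α * ghat g i + β * hhatperp g h i) ≤ enorm2 v ∧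
      rdot g (fun i => α * ghat g i + β * hhatperp g h i) = rdot g v ∧
      rdot h (fun i => α * ghat g i + β * hhatperp g h i) = rdot h v := by
  have huw := inner_ghat_hhatperp g h
  have hu := inner_normalize_smul_normalize (toLp 2 (star g))
  have hw := inner_normalize_smul_normalize (toLp 2 (hperp g h))
  have hg := norm_inv_smul_smul_self (toLp 2 (star g))
  have hh := norm_inv_smul_smul_self (toLp 2 (hperp g h))
  rw [← toLp_ghat] at hu hg
  rw [← toLp_hhatperp] at hw hh
  replace hh := eq_sub_iff_add_eq.mp (hh.trans (toLp_hperp g h))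
  obtain ⟨h1, h2⟩ := inner_projection_pair huw hu hw (toLp 2 v)
  have hle := norm_projection_pair_le huw hu hw (toLp 2 v)
  refine ⟨inner ℂ (toLp 2 (ghat g)) (toLp 2 v), inner ℂ (toLp 2 (hhatperp g h)) (toLp 2 v), ?_⟩
  have hp (α β : ℂ) : toLp 2 (fun i => α * ghat g i + β * hhatperp g h i) =
      α • toLp 2 (ghat g) + β • toLp 2 (hhatperp g h) := rfl
  simp only [enorm2_eq_norm_sq, rdot_eq_inner, hp]
  refine ⟨by gcongr, ?_, ?_⟩
  · rw [← hg, inner_smul_left, inner_smul_left, h1]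
  · rw [← hh, inner_add_left, inner_add_left, inner_smul_left, inner_smul_left, inner_smul_left,
      inner_smul_left, h1, h2]

theorem continuous_rdot {n : ℕ} (a : Fin n → ℂ) : Continuous (rdot a) := by
  unfold rdot
  fun_prop

theorem continuous_enorm2 {n : ℕ} : Continuous (enorm2 (n := n)) := by
  unfold enorm2
  fun_prop

theorem isCompact_setOf_enorm2_le {n : ℕ} (P : ℝ) :
    IsCompact {v : Fin n → ℂ | enorm2 v ≤ P} := by
  refine Metric.isCompact_of_isClosed_isBounded
    (isClosed_le continuous_enorm2 continuous_const) ?_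
  refine Metric.isBounded_closedBall.subset (t := Metric.closedBall 0 (Real.sqrt P)) fun v hv => ?_
  rw [mem_closedBall_zero_iff, pi_norm_le_iff_of_nonneg (Real.sqrt_nonneg _)]
  intro i
  refine Real.le_sqrt_of_sq_le (le_trans ?_ hv)
  exact Finset.single_le_sum (f := fun i => ‖v i‖ ^ 2) (fun _ _ => sq_nonneg _) (Finset.mem_univ i)

/-- For every feasible beamforming vector `v` there is one of the form
`v' = α ĝ + β ĥ⊥` that is also feasible and does at least as well; consequently the
maximum of `|h v|²` over the constraint set is attained in the span of `ĝ` and `ĥ⊥`. -/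
theorem stmt_2 (Mt : ℕ) (h g : Fin Mt → ℂ) (hg : g ≠ 0)
    (Pt γ : ℝ) (hPt : 0 < Pt) (hγ : 0 ≤ γ) :
    (∀ v : Fin Mt → ℂ, enorm2 v ≤ Pt → ‖rdot g v‖ ^ 2 ≤ γ →
      ∃ αv βv : ℂ,
        enorm2 (fun i => αv * ghat g i + βv * hhatperp g h i) ≤ Pt ∧
        ‖rdot g (fun i => αv * ghat g i + βv * hhatperp g h i)‖ ^ 2 ≤ γ ∧
        ‖rdot h v‖ ≤ ‖rdot h (fun i => αv * ghat g i + βv * hhatperp g h i)‖) ∧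
    (∃ αv βv : ℂ,
        enorm2 (fun i => αv * ghat g i + βv * hhatperp g h i) ≤ Pt ∧
        ‖rdot g (fun i => αv * ghat g i + βv * hhatperp g h i)‖ ^ 2 ≤ γ ∧
        ∀ v : Fin Mt → ℂ, enorm2 v ≤ Pt → ‖rdot g v‖ ^ 2 ≤ γ →
          ‖rdot h v‖ ^ 2 ≤ ‖rdot h (fun i => αv * ghat g i + βv * hhatperp g h i)‖ ^ 2) := by
  refine ⟨fun v hv hgv => ?_, ?_⟩
  · obtain ⟨α, β, hn, hg', hh'⟩ := exists_projection h g v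
    exact ⟨α, β, hn.trans hv, by rwa [hg'], by rw [hh']⟩
  · obtain ⟨v, ⟨hv, hgv⟩, hmax⟩ := ((isCompact_setOf_enorm2_le (n := Mt) Pt).inter_right
      (isClosed_le ((continuous_rdot g).norm.pow 2) (continuous_const (y := γ)))).exists_isMaxOn
      ⟨0, by simpa [enorm2] using hPt.le, by simpa [rdot] using hγ⟩
      ((continuous_rdot h).norm.pow 2).continuousOn
    obtain ⟨α, β, hn, hg', hh'⟩ := exists_projection h g v
    refine ⟨α, β, hn.trans hv, by rw [hg']; exact hgv, fun x hx hgx => ?_⟩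
    rw [hh']
    exact hmax ⟨hx, hgx⟩
end

section
/- Let H ∈ ℂ^{M_r×M_t}, let g ∈ ℂ^{1×M_t} be nonzero, set ĝ = g^†/‖g‖ and H⊥ = H(I − ĝ ĝ^†), and assume rank(H⊥) = min(M_r, M_t − 1). Fix γ > 0 and for P_t > 0 let R_opt(P_t) = sup { log₂ det(I + H S H^†) : S Hermitian positive semidefinite, Tr(S) ≤ P_t, g S g^† ≤ γ }. Then lim_{P_t → ∞} R_opt(P_t)/log₂ P_t = min(M_r, M_t − 1). -/
open Matrix Filter
open scoped ComplexOrder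

/-- The secondary user's capacity under transmit-power constraint `Pt` and
interference-power constraint `γ` at a single-antenna primary receiver. -/
noncomputable def Ropt (Mr Mt : ℕ) (H : Matrix (Fin Mr) (Fin Mt) ℂ)
    (g : Matrix (Fin 1) (Fin Mt) ℂ) (γ Pt : ℝ) : ℝ :=
  sSup {r : ℝ | ∃ S : Matrix (Fin Mt) (Fin Mt) ℂ, S.PosSemidef ∧
    S.trace.re ≤ Pt ∧ ((g * S * gᴴ) 0 0).re ≤ γ ∧
    r = Real.logb 2 ((1 + H * S * Hᴴ).det.re)}

/-- The projected channel `H⊥ = H (I − ĝ ĝᴴ)`, where `ĝ = gᴴ/‖g‖`,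
so that `ĝ ĝᴴ = gᴴ g / ‖g‖²`. -/
noncomputable def projChan (Mr Mt : ℕ) (H : Matrix (Fin Mr) (Fin Mt) ℂ)
    (g : Matrix (Fin 1) (Fin Mt) ℂ) : Matrix (Fin Mr) (Fin Mt) ℂ :=
  H * (1 - ((∑ i, ‖g 0 i‖ ^ 2 : ℝ) : ℂ)⁻¹ • (gᴴ * g))

namespace Matrix

variable {m n : Type*} [Fintype m] [Fintype n] [DecidableEq m] [DecidableEq n]

lemma IsHermitian.smul_one_add_smul_eq_conj {A : Matrix n n ℂ} (hA : A.IsHermitian) (a b : ℝ) :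
    (a : ℂ) • (1 : Matrix n n ℂ) + (b : ℂ) • A =
      (hA.eigenvectorUnitary : Matrix n n ℂ) *
        diagonal (fun i => ((a + b * hA.eigenvalues i : ℝ) : ℂ)) *
        (hA.eigenvectorUnitary : Matrix n n ℂ)ᴴ := by
  have hD : diagonal (fun i => ((a + b * hA.eigenvalues i : ℝ) : ℂ)) =
      (a : ℂ) • (1 : Matrix n n ℂ) + (b : ℂ) • diagonal (RCLike.ofReal ∘ hA.eigenvalues) := by
    ext i j
    by_cases h : i = j
    · subst h; simp
    · simp [h]
  have hU : (hA.eigenvectorUnitary : Matrix n n ℂ) * (hA.eigenvectorUnitary : Matrix n n ℂ)ᴴ = 1 :=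
    Unitary.coe_mul_star_self hA.eigenvectorUnitary
  have hs := hA.spectral_theorem
  rw [Unitary.conjStarAlgAut_apply, star_eq_conjTranspose] at hs
  rw [hD, mul_add, add_mul, Matrix.mul_smul, Matrix.smul_mul, mul_one, hU,
    Matrix.mul_smul, Matrix.smul_mul, ← hs]

lemma IsHermitian.det_smul_one_add_smul {A : Matrix n n ℂ} (hA : A.IsHermitian) (a b : ℝ) :
    ((a : ℂ) • (1 : Matrix n n ℂ) + (b : ℂ) • A).det =
      ((∏ i, (a + b * hA.eigenvalues i) : ℝ) : ℂ) := by
  have hU : (hA.eigenvectorUnitary : Matrix n n ℂ)ᴴ * (hA.eigenvectorUnitary : Matrix n n ℂ) = 1 :=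
    Unitary.coe_star_mul_self hA.eigenvectorUnitary
  rw [hA.smul_one_add_smul_eq_conj, det_mul_right_comm, det_mul, det_mul_comm, hU, det_one,
    one_mul, det_diagonal, Complex.ofReal_prod]

lemma PosSemidef.smul_one_sub_of_trace_le_s7 {A : Matrix n n ℂ} (hA : A.PosSemidef) {t : ℝ}
    (ht : A.trace.re ≤ t) : ((t : ℂ) • (1 : Matrix n n ℂ) - A).PosSemidef := by
  have h := hA.1.smul_one_add_smul_eq_conj t (-1)
  have hsub : (t : ℂ) • (1 : Matrix n n ℂ) + ((-1 : ℝ) : ℂ) • A = (t : ℂ) • 1 - A := by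
    simp [sub_eq_add_neg]
  rw [← hsub, h]
  refine PosSemidef.mul_mul_conjTranspose_same (PosSemidef.diagonal fun i => ?_) _
  have htr : A.trace.re = ∑ i, hA.1.eigenvalues i := by
    rw [hA.1.trace_eq_sum_eigenvalues]; simp
  have hi := Finset.single_le_sum (fun j _ => hA.eigenvalues_nonneg j) (Finset.mem_univ i)
  simp only [Pi.zero_apply]
  rw [Complex.zero_le_real]
  linarith

lemma PosSemidef.one_le_det_one_add_re {A : Matrix n n ℂ} (hA : A.PosSemidef) :
    1 ≤ (1 + A).det.re := by
  have h := hA.1.det_smul_one_add_smul 1 1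
  simp only [Complex.ofReal_one, one_smul, one_mul] at h
  rw [h, Complex.ofReal_re]
  exact Finset.one_le_prod fun i _ => by linarith [hA.eigenvalues_nonneg i]

open MatrixOrder in
lemma PosSemidef.exists_eq_conjTranspose_mul_self {A : Matrix n n ℂ} (hA : A.PosSemidef) :
    ∃ C : Matrix n n ℂ, A = Cᴴ * C :=
  CStarAlgebra.nonneg_iff_eq_star_mul_self.mp hA.nonneg

lemma PosDef.det_re_le_det_add {A B : Matrix n n ℂ} (hA : A.PosDef) (hB : B.PosSemidef) :
    A.det.re ≤ (A + B).det.re := by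
  obtain ⟨C, rfl⟩ := hA.posSemidef.exists_eq_conjTranspose_mul_self
  have hdet : IsUnit C.det := by
    have h := (isUnit_iff_isUnit_det _).mp hA.isUnit
    rw [det_mul] at h
    exact isUnit_of_mul_isUnit_right h
  set E := C⁻¹ᴴ * B * C⁻¹ with hE
  have hEpsd : E.PosSemidef := hB.conjTranspose_mul_mul_same C⁻¹
  have hCC : C⁻¹ * C = 1 := nonsing_inv_mul C hdet
  have hCC' : Cᴴ * C⁻¹ᴴ = 1 := by rw [← conjTranspose_mul, hCC, conjTranspose_one]
  have hsum : Cᴴ * C + B = Cᴴ * (1 + E) * C := by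
    rw [mul_add, add_mul, mul_one, hE]
    congr 1
    calc B = 1 * B * 1 := by simp
      _ = (Cᴴ * C⁻¹ᴴ) * B * (C⁻¹ * C) := by rw [hCC, hCC']
      _ = _ := by simp only [Matrix.mul_assoc]
  have hd : (Cᴴ * C + B).det = (Cᴴ * C).det * (1 + E).det := by
    rw [hsum, det_mul, det_mul, det_mul]; ring
  have h0 := Complex.pos_iff.mp hA.det_pos
  rw [hd, Complex.mul_re, ← h0.2, zero_mul, sub_zero]
  exact le_mul_of_one_le_right h0.1.le hEpsd.one_le_det_one_add_re

lemma PosSemidef.exists_pow_rank_le_det {A : Matrix n n ℂ} (hA : A.PosSemidef) {b : ℝ}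
    (hb : 0 < b) :
    ∃ c : ℝ, 0 < c ∧ ∀ t : ℝ, 0 ≤ t →
      c * t ^ A.rank ≤ (1 + ((b * t : ℝ) : ℂ) • A).det.re := by
  refine ⟨∏ i with hA.1.eigenvalues i ≠ 0, b * hA.1.eigenvalues i, ?_, fun t ht => ?_⟩
  · refine Finset.prod_pos fun i hi => mul_pos hb ?_
    exact lt_of_le_of_ne (hA.eigenvalues_nonneg i) (Finset.mem_filter.mp hi).2.symm
  · have h := hA.1.det_smul_one_add_smul 1 (b * t)
    rw [Complex.ofReal_one, one_smul] at h
    rw [h, Complex.ofReal_re, hA.1.rank_eq_card_non_zero_eigs, Fintype.card_subtype,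
      ← Finset.prod_const, ← Finset.prod_mul_distrib,
      ← Finset.prod_filter_mul_prod_filter_not Finset.univ (fun i => hA.1.eigenvalues i ≠ 0)
        (fun i => 1 + b * t * hA.1.eigenvalues i)]
    have hnn : ∀ i, 0 ≤ b * t * hA.1.eigenvalues i := fun i =>
      mul_nonneg (mul_nonneg hb.le ht) (hA.eigenvalues_nonneg i)
    refine (Finset.prod_le_prod (fun i _ => ?_) fun i _ => ?_).trans
      (le_mul_of_one_le_right (Finset.prod_nonneg fun i _ => ?_)
        (Finset.one_le_prod fun i _ => ?_))
    all_goals linarith [hnn i, mul_right_comm b t (hA.1.eigenvalues i)]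

lemma PosSemidef.exists_det_le_pow_rank {A : Matrix n n ℂ} (hA : A.PosSemidef) {a b : ℝ}
    (ha : 0 < a) (hb : 0 ≤ b) :
    ∃ c : ℝ, 0 < c ∧ ∀ t : ℝ, 1 ≤ t →
      ((a : ℂ) • (1 : Matrix n n ℂ) + ((b * t : ℝ) : ℂ) • A).det.re ≤ c * t ^ A.rank := by
  have hpos : ∀ i, 0 < a + b * hA.1.eigenvalues i := fun i =>
    add_pos_of_pos_of_nonneg ha (mul_nonneg hb (hA.eigenvalues_nonneg i))
  refine ⟨∏ i, (a + b * hA.1.eigenvalues i), Finset.prod_pos fun i _ => hpos i, fun t ht => ?_⟩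
  rw [hA.1.det_smul_one_add_smul, Complex.ofReal_re, hA.1.rank_eq_card_non_zero_eigs,
    Fintype.card_subtype, ← Finset.prod_const, Finset.prod_filter, ← Finset.prod_mul_distrib]
  refine Finset.prod_le_prod (fun i _ => ?_) fun i _ => ?_
  · have := mul_nonneg (mul_nonneg hb (zero_le_one.trans ht)) (hA.eigenvalues_nonneg i)
    linarith
  · split_ifs with h
    · nlinarith
    · simp [not_not.mp h]

lemma PosSemidef.smul_one_add_smul_sub_conj {k : Type*} [Fintype k] [DecidableEq k] {S : Matrix n n ℂ}
    (hS : S.PosSemidef) (X : Matrix m n ℂ) (h : Matrix m k ℂ) (g : Matrix k n ℂ) {t γ : ℝ}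
    (hγ : 0 ≤ γ) (ht : S.trace.re ≤ t) (hg : (g * S * gᴴ).trace.re ≤ γ) :
    (((2 * γ * (h * hᴴ).trace.re : ℝ) : ℂ) • (1 : Matrix m m ℂ) + ((2 * t : ℝ) : ℂ) • (X * Xᴴ) -
      (X + h * g) * S * (X + h * g)ᴴ).PosSemidef := by
  set τ := (h * hᴴ).trace.re with hτ
  have p1 := (hS.smul_one_sub_of_trace_le_s7 ht).mul_mul_conjTranspose_same X
  have p2 := ((hS.mul_mul_conjTranspose_same g).smul_one_sub_of_trace_le_s7 hg
    ).mul_mul_conjTranspose_same h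
  have p3 := ((posSemidef_self_mul_conjTranspose h).smul_one_sub_of_trace_le_s7 hτ.ge).smul
    (Complex.zero_le_real.mpr hγ)
  have p4 := hS.mul_mul_conjTranspose_same (X - h * g)
  have key := (((p1.add p1).add (p2.add p2)).add (p3.add p3)).add p4
  convert key using 1
  simp only [conjTranspose_add, conjTranspose_sub, conjTranspose_mul, Matrix.mul_add,
    Matrix.add_mul, Matrix.mul_sub, Matrix.sub_mul, Matrix.mul_assoc, Matrix.mul_smul,
    Matrix.smul_mul, Matrix.one_mul, Complex.ofReal_mul, smul_sub, smul_smul, Complex.ofReal_ofNat]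
  module

lemma exists_det_one_add_le_pow_rank {k : Type*} [Fintype k] [DecidableEq k]
    (X : Matrix m n ℂ) (h : Matrix m k ℂ) (g : Matrix k n ℂ) {γ : ℝ} (hγ : 0 ≤ γ) :
    ∃ c : ℝ, 0 < c ∧ ∀ t : ℝ, 1 ≤ t → ∀ S : Matrix n n ℂ, S.PosSemidef → S.trace.re ≤ t →
      (g * S * gᴴ).trace.re ≤ γ →
      (1 + (X + h * g) * S * (X + h * g)ᴴ).det.re ≤ c * t ^ X.rank := by
  have hτ : 0 ≤ (h * hᴴ).trace.re :=
    (Complex.le_def.mp (posSemidef_self_mul_conjTranspose h).trace_nonneg).1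
  obtain ⟨c, hc, hbound⟩ := (posSemidef_self_mul_conjTranspose X).exists_det_le_pow_rank
    (a := 1 + 2 * γ * (h * hᴴ).trace.re) (b := 2) (by positivity) zero_le_two
  rw [rank_self_mul_conjTranspose] at hbound
  refine ⟨c, hc, fun t ht S hS hSt hSg => le_trans ?_ (hbound t ht)⟩
  have hpd := PosDef.one.add_posSemidef (hS.mul_mul_conjTranspose_same (X + h * g))
  refine (hpd.det_re_le_det_add (hS.smul_one_add_smul_sub_conj X h g hγ hSt hSg)).trans_eq ?_
  congr 2
  rw [Complex.ofReal_add, add_smul, Complex.ofReal_one, one_smul]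
  abel

end Matrix

lemma tendsto_div_logb_of_pow_bounds {f : ℝ → ℝ} {c C : ℝ} {k : ℕ} (hc : 0 < c) (hC : 0 < C)
    (hlow : ∀ t : ℝ, 1 ≤ t → Real.logb 2 (c * t ^ k) ≤ f t)
    (hup : ∀ t : ℝ, 1 ≤ t → f t ≤ Real.logb 2 (C * t ^ k)) :
    Tendsto (fun t => f t / Real.logb 2 t) atTop (nhds (k : ℝ)) := by
  have hlog : Tendsto (Real.logb 2) atTop atTop := Real.tendsto_logb_atTop one_lt_two
  have key : ∀ d : ℝ, 0 < d →
      Tendsto (fun t => Real.logb 2 (d * t ^ k) / Real.logb 2 t) atTop (nhds (k : ℝ)) := by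
    intro d hd
    have h1 : Tendsto (fun t => Real.logb 2 d / Real.logb 2 t + k) atTop (nhds (0 + (k : ℝ))) :=
      (hlog.const_div_atTop _).add_const _
    rw [zero_add] at h1
    refine h1.congr' ?_
    filter_upwards [eventually_gt_atTop 1] with t ht
    have hl : 0 < Real.logb 2 t := Real.logb_pos one_lt_two ht
    rw [Real.logb_mul hd.ne' (by positivity), Real.logb_pow]
    field_simp
  refine tendsto_of_tendsto_of_tendsto_of_le_of_le' (key c hc) (key C hC) ?_ ?_
  · filter_upwards [eventually_gt_atTop 1] with t ht
    have hl : 0 < Real.logb 2 t := Real.logb_pos one_lt_two ht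
    gcongr
    exact hlow t ht.le
  · filter_upwards [eventually_gt_atTop 1] with t ht
    have hl : 0 < Real.logb 2 t := Real.logb_pos one_lt_two ht
    gcongr
    exact hup t ht.le

/-- High-power spatial multiplexing gain: if `rank H⊥ = min(Mr, Mt − 1)`, then
`R_opt(Pt)/log₂ Pt → min(Mr, Mt − 1)` as `Pt → ∞`. -/
theorem stmt_7 (Mr Mt : ℕ) (H : Matrix (Fin Mr) (Fin Mt) ℂ)
    (g : Matrix (Fin 1) (Fin Mt) ℂ) (hg : g ≠ 0)
    (hrank : (projChan Mr Mt H g).rank = min Mr (Mt - 1))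
    (γ : ℝ) (hγ : 0 < γ) :
    Filter.Tendsto (fun Pt => Ropt Mr Mt H g γ Pt / Real.logb 2 Pt) Filter.atTop
      (nhds ((min Mr (Mt - 1) : ℕ) : ℝ)) := by
  set c : ℂ := ((∑ i, ‖g 0 i‖ ^ 2 : ℝ) : ℂ) with hc
  set Q : Matrix (Fin Mt) (Fin Mt) ℂ := 1 - c⁻¹ • (gᴴ * g) with hQ
  set X := projChan Mr Mt H g with hX
  have hXQ : X = H * Q := rfl
  have hc0 : c ≠ 0 := by
    obtain ⟨i, hi⟩ : ∃ i, g 0 i ≠ 0 := by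
      by_contra! h0
      exact hg (by ext a i; rw [Subsingleton.elim a 0]; exact h0 i)
    rw [hc, Complex.ofReal_ne_zero]
    exact (Finset.sum_pos' (fun j _ => by positivity)
      ⟨i, Finset.mem_univ i, by positivity⟩).ne'
  have hgg : g * gᴴ = c • (1 : Matrix (Fin 1) (Fin 1) ℂ) := by
    ext a b
    rw [Subsingleton.elim a 0, Subsingleton.elim b 0]
    simp [Matrix.mul_apply, hc, Complex.mul_conj, Complex.normSq_eq_norm_sq]
  have hgQ : g * Q = 0 := by
    rw [hQ, Matrix.mul_sub, Matrix.mul_smul, ← Matrix.mul_assoc, hgg, Matrix.smul_mul, smul_smul,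
      inv_mul_cancel₀ hc0, one_smul, Matrix.one_mul, Matrix.mul_one, sub_self]
  have hQH : Qᴴ = Q := by
    rw [hQ, conjTranspose_sub, conjTranspose_one, conjTranspose_smul, conjTranspose_mul,
      conjTranspose_conjTranspose, star_inv₀, hc, Complex.star_def, Complex.conj_ofReal]
  have hQQ : Q * Qᴴ = Q := by
    rw [hQH]
    nth_rw 1 [hQ]
    rw [Matrix.sub_mul, Matrix.smul_mul, Matrix.mul_assoc, hgQ]
    simp
  have hQpsd : Q.PosSemidef := hQQ ▸ posSemidef_self_mul_conjTranspose Q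
  have hXX : X * Xᴴ = H * Q * Hᴴ := by
    rw [hXQ, conjTranspose_mul, Matrix.mul_assoc, ← Matrix.mul_assoc Q, hQQ, Matrix.mul_assoc]
  have hH : H = X + (c⁻¹ • (H * gᴴ)) * g := by
    rw [hXQ, hQ, Matrix.mul_sub, Matrix.mul_one, Matrix.mul_smul, Matrix.smul_mul,
      Matrix.mul_assoc, sub_add_cancel]
  obtain ⟨C, hC, hupper⟩ := exists_det_one_add_le_pow_rank X (c⁻¹ • (H * gᴴ)) g hγ.le
  rw [← hH, hrank] at hupper
  set b : ℝ := (|Q.trace.re| + 1)⁻¹ with hb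
  have hb0 : 0 < b := by positivity
  have hbtr : b * Q.trace.re ≤ 1 := by
    rw [hb, inv_mul_le_one₀ (by positivity)]
    linarith [le_abs_self Q.trace.re]
  obtain ⟨d, hd, hlower⟩ := (posSemidef_self_mul_conjTranspose X).exists_pow_rank_le_det hb0
  rw [rank_self_mul_conjTranspose, hrank] at hlower
  have hmem : ∀ t : ℝ, 1 ≤ t → ∀ r ∈ {r : ℝ | ∃ S : Matrix (Fin Mt) (Fin Mt) ℂ, S.PosSemidef ∧
      S.trace.re ≤ t ∧ ((g * S * gᴴ) 0 0).re ≤ γ ∧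
      r = Real.logb 2 ((1 + H * S * Hᴴ).det.re)},
      r ≤ Real.logb 2 (C * t ^ min Mr (Mt - 1)) := by
    rintro t ht r ⟨S, hS, hSt, hSg, rfl⟩
    refine Real.logb_le_logb_of_le one_lt_two ?_
      (hupper t ht S hS hSt (by rwa [Matrix.trace_fin_one]))
    exact zero_lt_one.trans_le (hS.mul_mul_conjTranspose_same H).one_le_det_one_add_re
  have hfeas : ∀ t : ℝ, 1 ≤ t → Real.logb 2 ((1 + ((b * t : ℝ) : ℂ) • (X * Xᴴ)).det.re) ∈
      {r : ℝ | ∃ S : Matrix (Fin Mt) (Fin Mt) ℂ, S.PosSemidef ∧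
      S.trace.re ≤ t ∧ ((g * S * gᴴ) 0 0).re ≤ γ ∧
      r = Real.logb 2 ((1 + H * S * Hᴴ).det.re)} := by
    intro t ht
    have ht0 : 0 ≤ t := zero_le_one.trans ht
    refine ⟨((b * t : ℝ) : ℂ) • Q, hQpsd.smul (Complex.zero_le_real.mpr (by positivity)), ?_, ?_, ?_⟩
    · rw [trace_smul, smul_eq_mul, Complex.re_ofReal_mul]
      nlinarith
    · rw [Matrix.mul_smul, hgQ]
      simpa using hγ.le
    · rw [hXX, Matrix.mul_smul, Matrix.smul_mul]
  refine tendsto_div_logb_of_pow_bounds hd hC (fun t ht => ?_) fun t ht => ?_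
  · refine le_trans ?_ (le_csSup ⟨_, hmem t ht⟩ (hfeas t ht))
    exact Real.logb_le_logb_of_le one_lt_two (by positivity) (hlower t (zero_le_one.trans ht))
  · exact csSup_le ⟨_, hfeas t ht⟩ (hmem t ht)
end

section
/- Let M ≥ 1, let λ₁,…,λ_M > 0 and α₁,…,α_M > 0 be real numbers, and let γ ≥ 0. For every P_t > 0, the supremum of Σ_{i=1}^{M} log₂(1 + λ_i σ_i) over all real σ₁,…,σ_M ≥ 0 with Σ_i σ_i ≤ P_t and Σ_i α_i σ_i ≤ γ is at most Σ_{i=1}^{M} log₂(1 + λ_i γ / α_i), a bound independent of P_t. Consequently, denoting this supremum by R_{D-SVD}(P_t), one has lim_{P_t → ∞} R_{D-SVD}(P_t)/log₂ P_t = 0. -/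
open Filter

/-- The D-SVD achievable rate: supremum of the sum rate over nonnegative power
allocations subject to the total-power and interference-power constraints. -/
noncomputable def RDSVD (M : ℕ) (lam alp : Fin M → ℝ) (γ Pt : ℝ) : ℝ :=
  sSup {r : ℝ | ∃ σ : Fin M → ℝ, (∀ i, 0 ≤ σ i) ∧ (∑ i, σ i) ≤ Pt ∧
    (∑ i, alp i * σ i) ≤ γ ∧ r = ∑ i, Real.logb 2 (1 + lam i * σ i)}

theorem le_div_of_sum_mul_le {ι : Type*} [Fintype ι] {a σ : ι → ℝ} {γ : ℝ}
    (ha : ∀ i, 0 < a i) (hσ : ∀ i, 0 ≤ σ i) (h : ∑ i, a i * σ i ≤ γ) (i : ι) :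
    σ i ≤ γ / a i := by
  rw [le_div_iff₀' (ha i)]
  exact (Finset.single_le_sum (f := fun j => a j * σ j)
    (fun j _ => mul_nonneg (ha j).le (hσ j)) (Finset.mem_univ i)).trans h

theorem logb_two_one_add_nonneg {x : ℝ} (hx : 0 ≤ x) : 0 ≤ Real.logb 2 (1 + x) :=
  Real.logb_nonneg one_lt_two (le_add_of_nonneg_right hx)

theorem RDSVD_nonneg {M : ℕ} {lam : Fin M → ℝ} (hlam : ∀ i, 0 < lam i) (alp : Fin M → ℝ)
    (γ Pt : ℝ) : 0 ≤ RDSVD M lam alp γ Pt := by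
  refine Real.sSup_nonneg ?_
  rintro r ⟨σ, hσ, -, -, rfl⟩
  exact Finset.sum_nonneg fun i _ =>
    logb_two_one_add_nonneg (mul_nonneg (hlam i).le (hσ i))

theorem RDSVD_le {M : ℕ} {lam alp : Fin M → ℝ} (hlam : ∀ i, 0 < lam i)
    (halp : ∀ i, 0 < alp i) {γ : ℝ} (hγ : 0 ≤ γ) (Pt : ℝ) :
    RDSVD M lam alp γ Pt ≤ ∑ i, Real.logb 2 (1 + lam i * γ / alp i) := by
  refine Real.sSup_le ?_ (Finset.sum_nonneg fun i _ => logb_two_one_add_nonneg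
    (div_nonneg (mul_nonneg (hlam i).le hγ) (halp i).le))
  rintro r ⟨σ, hσ, -, hint, rfl⟩
  refine Finset.sum_le_sum fun i _ => ?_
  have hpos : 0 < 1 + lam i * σ i :=
    add_pos_of_pos_of_nonneg one_pos (mul_nonneg (hlam i).le (hσ i))
  refine Real.logb_le_logb_of_le one_lt_two hpos ?_
  rw [mul_div_assoc]
  have := mul_le_mul_of_nonneg_left (le_div_of_sum_mul_le halp hσ hint i) (hlam i).le
  linarith

/-- The D-SVD rate is bounded, uniformly in `Pt`, by `Σ log₂(1 + λᵢ γ/αᵢ)`;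
consequently `R_{D-SVD}(Pt)/log₂ Pt → 0` as `Pt → ∞` (zero multiplexing gain). -/
theorem stmt_8 (M : ℕ) (hM : 1 ≤ M) (lam alp : Fin M → ℝ)
    (hlam : ∀ i, 0 < lam i) (halp : ∀ i, 0 < alp i) (γ : ℝ) (hγ : 0 ≤ γ) :
    (∀ Pt : ℝ, 0 < Pt →
      RDSVD M lam alp γ Pt ≤ ∑ i, Real.logb 2 (1 + lam i * γ / alp i)) ∧
    Filter.Tendsto (fun Pt => RDSVD M lam alp γ Pt / Real.logb 2 Pt)
      Filter.atTop (nhds 0) := by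
  refine ⟨fun Pt _ => RDSVD_le hlam halp hγ Pt, ?_⟩
  refine squeeze_zero' ?_ ?_
    ((Real.tendsto_logb_atTop one_lt_two).const_div_atTop
      (∑ i, Real.logb 2 (1 + lam i * γ / alp i)))
  · filter_upwards [eventually_ge_atTop 1] with Pt hPt
    exact div_nonneg (RDSVD_nonneg hlam alp γ Pt) (Real.logb_nonneg one_lt_two hPt)
  · filter_upwards [eventually_ge_atTop 1] with Pt hPt
    exact div_le_div_of_nonneg_right (RDSVD_le hlam halp hγ Pt)
      (Real.logb_nonneg one_lt_two hPt)
end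

section
/- Let H ∈ ℂ^{M_r×M_t}, let g ∈ ℂ^{1×M_t} be nonzero, set ĝ = g^†/‖g‖ and H⊥ = H(I − ĝ ĝ^†), and let P_t > 0. Then sup { log₂ det(I + H S H^†) : S Hermitian positive semidefinite, Tr(S) ≤ P_t, g S g^† = 0 } = sup { log₂ det(I + H⊥ S H⊥^†) : S Hermitian positive semidefinite, Tr(S) ≤ P_t }. That is, when the interference-power constraint is γ = 0, the secondary capacity equals the unconstrained capacity of the projected channel H⊥ (so the P-SVD strategy is optimal). -/
open Matrix
open scoped ComplexOrder

/-- The orthogonal projection onto the complement of the line spanned by `gᴴ`. -/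
noncomputable def rowComplProj {n : ℕ} (g : Matrix (Fin 1) (Fin n) ℂ) :
    Matrix (Fin n) (Fin n) ℂ :=
  1 - ((∑ i, ‖g 0 i‖ ^ 2 : ℝ) : ℂ)⁻¹ • (gᴴ * g)

lemma mul_conjTranspose_row {n : ℕ} (g : Matrix (Fin 1) (Fin n) ℂ) :
    g * gᴴ = ((∑ i, ‖g 0 i‖ ^ 2 : ℝ) : ℂ) • (1 : Matrix (Fin 1) (Fin 1) ℂ) := by
  ext i j
  fin_cases i
  fin_cases j
  simp [Matrix.mul_apply, Complex.mul_conj']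

lemma sum_norm_sq_row_ne_zero {n : ℕ} {g : Matrix (Fin 1) (Fin n) ℂ} (hg : g ≠ 0) :
    ((∑ i, ‖g 0 i‖ ^ 2 : ℝ) : ℂ) ≠ 0 := by
  intro h
  apply hg
  have h' : ∑ i, ‖g 0 i‖ ^ 2 = 0 := by exact_mod_cast h
  rw [Finset.sum_eq_zero_iff_of_nonneg fun i _ => by positivity] at h'
  ext i j
  fin_cases i
  simpa using h' j (Finset.mem_univ j)

lemma conjTranspose_rowComplProj {n : ℕ} (g : Matrix (Fin 1) (Fin n) ℂ) :
    (rowComplProj g)ᴴ = rowComplProj g := by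
  simp [rowComplProj, conjTranspose_sub, conjTranspose_smul, conjTranspose_mul]

lemma mul_rowComplProj {n : ℕ} {g : Matrix (Fin 1) (Fin n) ℂ} (hg : g ≠ 0) :
    g * rowComplProj g = 0 := by
  rw [rowComplProj, Matrix.mul_sub, Matrix.mul_one, Matrix.mul_smul, ← Matrix.mul_assoc,
    mul_conjTranspose_row, Matrix.smul_mul, Matrix.one_mul, smul_smul,
    inv_mul_cancel₀ (sum_norm_sq_row_ne_zero hg), one_smul, sub_self]

lemma rowComplProj_mul_self {n : ℕ} {g : Matrix (Fin 1) (Fin n) ℂ} (hg : g ≠ 0) :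
    rowComplProj g * rowComplProj g = rowComplProj g := by
  conv_lhs => enter [1]; rw [rowComplProj]
  rw [Matrix.sub_mul, Matrix.smul_mul, Matrix.mul_assoc, mul_rowComplProj hg]
  simp

lemma mul_conjTranspose_row_eq_zero {n : ℕ} {g : Matrix (Fin 1) (Fin n) ℂ}
    {S : Matrix (Fin n) (Fin n) ℂ} (hS : S.PosSemidef) (h : (g * S * gᴴ) 0 0 = 0) :
    S * gᴴ = 0 := by
  have hx : S *ᵥ star (g 0) = 0 := by
    rw [← hS.dotProduct_mulVec_zero_iff, star_star, ← h, Matrix.mul_assoc]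
    simp only [Matrix.mul_apply', dotProduct, mulVec]
    rfl
  ext i j
  fin_cases j
  exact congrFun hx i

lemma trace_rowComplProj_conj_le {n : ℕ} {g : Matrix (Fin 1) (Fin n) ℂ} (hg : g ≠ 0)
    {S : Matrix (Fin n) (Fin n) ℂ} (hS : S.PosSemidef) :
    (rowComplProj g * S * rowComplProj g).trace.re ≤ S.trace.re := by
  have hnn : 0 ≤ (g * S * gᴴ).trace.re :=
    (Complex.le_def.1 (hS.mul_mul_conjTranspose_same g).trace_nonneg).1
  have hc : 0 ≤ (∑ i, ‖g 0 i‖ ^ 2)⁻¹ := by positivity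
  rw [Matrix.trace_mul_comm, ← Matrix.mul_assoc, rowComplProj_mul_self hg, rowComplProj,
    Matrix.sub_mul, Matrix.one_mul, trace_sub, Matrix.smul_mul, trace_smul, Matrix.mul_assoc,
    Matrix.trace_mul_comm, smul_eq_mul, ← Complex.ofReal_inv, Complex.sub_re, Complex.re_ofReal_mul]
  exact sub_le_self _ (mul_nonneg hc hnn)

lemma projChan_mul_mul_conjTranspose {m n : ℕ} (H : Matrix (Fin m) (Fin n) ℂ)
    (g : Matrix (Fin 1) (Fin n) ℂ) (S : Matrix (Fin n) (Fin n) ℂ) :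
    projChan m n H g * S * (projChan m n H g)ᴴ =
      H * (rowComplProj g * S * rowComplProj g) * Hᴴ := by
  have h : projChan m n H g = H * rowComplProj g := rfl
  simp only [h, conjTranspose_mul, conjTranspose_rowComplProj, Matrix.mul_assoc]

/-- Optimality of the P-SVD at `γ = 0`: the secondary capacity under the zero-interference
constraint equals the unconstrained capacity of the projected channel `H⊥`. -/
theorem stmt_10 (Mr Mt : ℕ) (H : Matrix (Fin Mr) (Fin Mt) ℂ)
    (g : Matrix (Fin 1) (Fin Mt) ℂ) (hg : g ≠ 0) (Pt : ℝ) (hPt : 0 < Pt) :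
    sSup {r : ℝ | ∃ S : Matrix (Fin Mt) (Fin Mt) ℂ, S.PosSemidef ∧ S.trace.re ≤ Pt ∧
        (g * S * gᴴ) 0 0 = 0 ∧ r = Real.logb 2 ((1 + H * S * Hᴴ).det.re)} =
    sSup {r : ℝ | ∃ S : Matrix (Fin Mt) (Fin Mt) ℂ, S.PosSemidef ∧ S.trace.re ≤ Pt ∧
        r = Real.logb 2 ((1 + projChan Mr Mt H g * S * (projChan Mr Mt H g)ᴴ).det.re)} := by
  congr 1
  ext r
  constructor
  · rintro ⟨S, hS, htr, h0, rfl⟩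
    have h1 : S * gᴴ = 0 := mul_conjTranspose_row_eq_zero hS h0
    have hSP : S * rowComplProj g = S := by
      rw [rowComplProj, Matrix.mul_sub, Matrix.mul_smul, ← Matrix.mul_assoc, h1]
      simp
    have hPS : rowComplProj g * S = S := by
      simpa [conjTranspose_mul, conjTranspose_rowComplProj, hS.isHermitian.eq] using
        congrArg conjTranspose hSP
    exact ⟨S, hS, htr, by rw [projChan_mul_mul_conjTranspose, hPS, hSP]⟩
  · rintro ⟨S, hS, htr, rfl⟩
    refine ⟨rowComplProj g * S * rowComplProj g, ?_,
      (trace_rowComplProj_conj_le hg hS).trans htr, ?_, ?_⟩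
    · simpa only [conjTranspose_rowComplProj] using hS.mul_mul_conjTranspose_same (rowComplProj g)
    · simp [← Matrix.mul_assoc, mul_rowComplProj hg]
    · rw [projChan_mul_mul_conjTranspose]
end

section
/- Let S₁, S₂ ∈ ℂ^{n×n} be Hermitian positive semidefinite matrices. Then det(I + S₁ + S₂) ≤ det(I + S₁) · det(I + S₂). -/
open Matrix
open scoped ComplexOrder

namespace Matrix

variable {m : Type*} [Fintype m] [DecidableEq m]

lemma PosSemidef.one_le_det_one_add_s12 {X : Matrix m m ℂ} (hX : X.PosSemidef) :
    1 ≤ (1 + X).det := by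
  have h := congrArg (Polynomial.eval (-1 : ℂ)) hX.isHermitian.charpoly_eq
  rw [eval_charpoly, Polynomial.eval_prod] at h
  have hneg : scalar m (-1 : ℂ) - X = -(1 + X) := by
    rw [map_neg, map_one]; abel
  have hprod : (1 + X).det = ∏ i, (1 + (hX.isHermitian.eigenvalues i : ℂ)) := by
    have hfactor (i : m) : (-1 : ℂ) - hX.isHermitian.eigenvalues i =
        -(1 + hX.isHermitian.eigenvalues i) := by ring
    rw [hneg, det_neg] at h
    simp only [Polynomial.eval_sub, Polynomial.eval_X, Polynomial.eval_C,
      Complex.coe_algebraMap, hfactor, Finset.prod_neg, Finset.card_univ] at h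
    exact mul_left_cancel₀ (pow_ne_zero _ (by norm_num)) h
  rw [hprod]
  have hone (i : m) : 1 ≤ 1 + hX.isHermitian.eigenvalues i := by
    linarith [hX.eigenvalues_nonneg i]
  exact_mod_cast Finset.one_le_prod fun i _ => hone i

open scoped MatrixOrder in
lemma PosSemidef.exists_eq_conjTranspose_mul_self_s12 {X : Matrix m m ℂ} (hX : X.PosSemidef) :
    ∃ B : Matrix m m ℂ, X = Bᴴ * B :=
  CStarAlgebra.nonneg_iff_eq_star_mul_self.mp hX.nonneg

lemma PosDef.det_add_conjTranspose_mul_self {Q : Matrix m m ℂ} (hQ : Q.PosDef)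
    (B : Matrix m m ℂ) : (Q + Bᴴ * B).det = Q.det * (1 + B * Q⁻¹ * Bᴴ).det := by
  have hu : IsUnit Q.det := hQ.det_pos.ne'.isUnit
  have h : Q + Bᴴ * B = Q * (1 + Q⁻¹ * Bᴴ * B) := by
    rw [mul_add, mul_one, Matrix.mul_assoc, mul_nonsing_inv_cancel_left _ _ hu]
  rw [h, det_mul, det_one_add_mul_comm, Matrix.mul_assoc B]

lemma PosDef.det_le_det_add_s12 {Q R : Matrix m m ℂ} (hQ : Q.PosDef) (hR : R.PosSemidef) :
    Q.det ≤ (Q + R).det := by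
  obtain ⟨C, rfl⟩ := hR.exists_eq_conjTranspose_mul_self_s12
  rw [hQ.det_add_conjTranspose_mul_self]
  exact le_mul_of_one_le_right hQ.det_pos.le
    (hQ.inv.posSemidef.mul_mul_conjTranspose_same C).one_le_det_one_add_s12

lemma PosSemidef.one_sub_inv_one_add {S : Matrix m m ℂ} (hS : S.PosSemidef) :
    (1 - (1 + S)⁻¹).PosSemidef := by
  have hP : (1 + S).PosDef := PosDef.one.add_posSemidef hS
  have hu : IsUnit (1 + S).det := hP.det_pos.ne'.isUnit
  have hSS : (S + Sᴴ * S).PosSemidef := hS.add (posSemidef_conjTranspose_mul_self S)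
  have h := hSS.mul_mul_conjTranspose_same (1 + S)⁻¹
  rw [hP.inv.isHermitian.eq, hS.isHermitian.eq] at h
  have hS' : S + S * S = (1 + S) * ((1 + S) - 1) := by noncomm_ring
  rwa [hS', nonsing_inv_mul_cancel_left _ _ hu, sub_mul, one_mul, mul_nonsing_inv _ hu] at h

theorem PosSemidef.det_one_add_add_le {S T : Matrix m m ℂ} (hS : S.PosSemidef)
    (hT : T.PosSemidef) : (1 + S + T).det ≤ (1 + S).det * (1 + T).det := by
  have hP : (1 + S).PosDef := PosDef.one.add_posSemidef hS
  obtain ⟨B, rfl⟩ := hT.exists_eq_conjTranspose_mul_self_s12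
  rw [hP.det_add_conjTranspose_mul_self, det_one_add_mul_comm Bᴴ B]
  refine mul_le_mul_of_nonneg_left ?_ hP.det_pos.le
  have hQ : (1 + B * (1 + S)⁻¹ * Bᴴ).PosDef :=
    PosDef.one.add_posSemidef (hP.inv.posSemidef.mul_mul_conjTranspose_same B)
  convert hQ.det_le_det_add_s12 (hS.one_sub_inv_one_add.mul_mul_conjTranspose_same B) using 2
  noncomm_ring

end Matrix

/-- Determinant subadditivity for positive semidefinite matrices:
`det(I + S₁ + S₂) ≤ det(I + S₁) · det(I + S₂)`. -/
theorem stmt_12 (n : ℕ) (S₁ S₂ : Matrix (Fin n) (Fin n) ℂ)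
    (h1 : S₁.PosSemidef) (h2 : S₂.PosSemidef) :
    (1 + S₁ + S₂).det.re ≤ (1 + S₁).det.re * (1 + S₂).det.re := by
  have him : (1 + S₁).det.im = 0 :=
    (Complex.le_def.mp (PosDef.one.add_posSemidef h1).det_pos.le).2.symm
  simpa [Complex.mul_re, him] using (Complex.le_def.mp (h1.det_one_add_add_le h2)).1
end

section
/- Let M ∈ ℂ^{n×n} be Hermitian positive semidefinite of rank r, and let φ > 0 and Γ ≥ 0. Then det(I + (1/(φ+Γ)) M) ≥ (φ/(φ+Γ))^r · det(I + (1/φ) M). -/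
open Matrix
open scoped ComplexOrder

theorem Matrix.IsHermitian.det_one_add_smul_eq_prod {𝕜 m : Type*} [RCLike 𝕜] [Fintype m]
    [DecidableEq m] {A : Matrix m m 𝕜} (hA : A.IsHermitian) (c : 𝕜) :
    (1 + c • A).det = ∏ i, (1 + c * (hA.eigenvalues i : 𝕜)) := by
  have h : 1 + c • A = Unitary.conjStarAlgAut 𝕜 _ hA.eigenvectorUnitary
      (diagonal fun i => 1 + c * (hA.eigenvalues i : 𝕜)) := by
    have hd : (diagonal fun i => 1 + c * (hA.eigenvalues i : 𝕜)) =
        1 + c • diagonal (RCLike.ofReal ∘ hA.eigenvalues) := by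
      rw [← diagonal_one, ← diagonal_smul, diagonal_add]
      rfl
    rw [hd, map_add, map_one, map_smul, ← hA.spectral_theorem]
  rw [h, Unitary.conjStarAlgAut_apply, det_mul_comm, ← mul_assoc, Unitary.coe_star_mul_self,
    one_mul, det_diagonal]

theorem Matrix.IsHermitian.re_det_one_add_ofReal_inv_smul {m : Type*} [Fintype m]
    [DecidableEq m] {A : Matrix m m ℂ} (hA : A.IsHermitian) (c : ℝ) :
    (1 + (c : ℂ)⁻¹ • A).det.re = ∏ i, (1 + c⁻¹ * hA.eigenvalues i) := by
  rw [hA.det_one_add_smul_eq_prod, ← Complex.ofReal_re (∏ i, (1 + c⁻¹ * hA.eigenvalues i))]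
  push_cast
  rfl

/-- Rank-dependent determinant scaling: for `M ⪰ 0` of rank `r`, `φ > 0`, `Γ ≥ 0`,
`det(I + M/(φ+Γ)) ≥ (φ/(φ+Γ))^r · det(I + M/φ)`. -/
theorem stmt_17 (n : ℕ) (M : Matrix (Fin n) (Fin n) ℂ) (hM : M.PosSemidef)
    (φ Γ : ℝ) (hφ : 0 < φ) (hΓ : 0 ≤ Γ) :
    (φ / (φ + Γ)) ^ M.rank * (1 + (φ : ℂ)⁻¹ • M).det.re
      ≤ (1 + ((φ + Γ : ℝ) : ℂ)⁻¹ • M).det.re := by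
  have hM' := hM.isHermitian
  rw [hM'.re_det_one_add_ofReal_inv_smul, hM'.re_det_one_add_ofReal_inv_smul,
    hM'.rank_eq_card_non_zero_eigs, Fintype.card_subtype, ← Finset.prod_const,
    Finset.prod_filter, ← Finset.prod_mul_distrib]
  have hs : 0 < φ + Γ := by positivity
  refine Finset.prod_le_prod (fun i _ => ?_) (fun i _ => ?_) <;>
    have hμ := hM.eigenvalues_nonneg i
  · split_ifs <;> positivity
  · split_ifs with h
    · have e : φ / (φ + Γ) * (1 + φ⁻¹ * hM'.eigenvalues i) =
          φ / (φ + Γ) + (φ + Γ)⁻¹ * hM'.eigenvalues i := by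
        field_simp
      rw [e]
      gcongr
      exact (div_le_one hs).2 (by linarith)
    · simp [not_not.1 h]
end
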